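/- Let X be a finite simple non-degenerate cycle set with |X| > 1. Then the following are equivalent: (1) Dis(X) is a cyclic group; (2) Dis(X) is the trivial group; (3) |X| = 2, or X is an indecomposable cycle set of prime cardinality. -/

import Mathlib

/-- The permutation group `G(X)` of a left quasigroup, generated by the left translations. -/
def permGroup {X : Type*} (σ : X → Equiv.Perm X) : Subgroup (Equiv.Perm X) :=
  Subgroup.closure (Set.range σ)

/-- The left translation `σ_x` as an element of `G(X)`. -/
def sigmaG {X : Type*} (σ : X → Equiv.Perm X) (x : X) : permGroup σ :=
  ⟨σ x, Subgroup.subset_closure ⟨x, rfl⟩⟩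

/-- The displacement group `Dis(X)`: the normal closure in `G(X)` of the
elements `σ_x ∘ σ_y⁻¹`. -/
def dis {X : Type*} (σ : X → Equiv.Perm X) : Subgroup ↥(permGroup σ) :=
  Subgroup.normalClosure {g : ↥(permGroup σ) | ∃ x y : X, (g : Equiv.Perm X) = σ x * (σ y)⁻¹}

/-- A left quasigroup is indecomposable if `G(X)` acts transitively. -/
def Indecomposable {X : Type*} (σ : X → Equiv.Perm X) : Prop :=
  ∀ x y : X, ∃ g ∈ permGroup σ, g x = y

/-- A left quasigroup is irretractable if `σ_x = σ_y` implies `x = y`. -/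
def Irretractable {X : Type*} (σ : X → Equiv.Perm X) : Prop :=
  ∀ x y : X, σ x = σ y → x = y

/-- A left quasigroup is latin if every right translation is bijective. -/
def LatinLQ {X : Type*} (σ : X → Equiv.Perm X) : Prop :=
  ∀ x : X, Function.Bijective fun y => σ y x

/-- A congruence of a left quasigroup. -/
def IsCongruence {X : Type*} (σ : X → Equiv.Perm X) (r : X → X → Prop) : Prop :=
  Equivalence r ∧
  (∀ x x' y y' : X, r x x' → r y y' → r (σ x y) (σ x' y')) ∧
  (∀ x x' y y' : X, r x x' → r y y' → r ((σ x).symm y) ((σ x').symm y'))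

/-- A left quasigroup is simple if it is indecomposable and its only congruences are
the equality relation and the total relation. -/
def SimpleLQ {X : Type*} (σ : X → Equiv.Perm X) : Prop :=
  Indecomposable σ ∧ ∀ r : X → X → Prop, IsCongruence σ r →
    (∀ a b : X, r a b ↔ a = b) ∨ (∀ a b : X, r a b)

/-- The cycle set identity `(x·y)·(x·z) = (y·x)·(y·z)`. -/
def CycleSetLaw {X : Type*} (σ : X → Equiv.Perm X) : Prop :=
  ∀ x y z : X, σ (σ x y) (σ x z) = σ (σ y x) (σ y z)

/-- Non-degeneracy: the squaring map `x ↦ x·x` is bijective. -/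
def Nondeg {X : Type*} (σ : X → Equiv.Perm X) : Prop :=
  Function.Bijective fun x : X => σ x x

/-- The displacement group acts transitively. -/
def DisTransitive {X : Type*} (σ : X → Equiv.Perm X) : Prop :=
  ∀ x y : X, ∃ g ∈ dis σ, (g : Equiv.Perm X) x = y

section AdditiveStructure

variable {X : Type*} {σ : X → Equiv.Perm X}

/-- One step of the fold that evaluates a multiset of points to a permutation. -/
def translationStep (σ : X → Equiv.Perm X) (τ : Equiv.Perm X) (x : X) : Equiv.Perm X :=
  σ (τ x) * τ

theorem CycleSetLaw.rightCommutative (hlaw : CycleSetLaw σ) :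
    RightCommutative (translationStep σ) :=
  ⟨fun τ x y => Equiv.ext fun z => by
    simpa [translationStep] using hlaw (τ x) (τ y) (τ z)⟩

/-- The permutation attached to an element of the free commutative monoid on `X`; it extends
`x ↦ σ x` to an anti-cocycle. -/
def multisetPerm (hlaw : CycleSetLaw σ) (s : Multiset X) : Equiv.Perm X :=
  haveI := hlaw.rightCommutative
  s.foldl (translationStep σ) 1

variable (hlaw : CycleSetLaw σ)

@[simp]
theorem multisetPerm_zero : multisetPerm hlaw 0 = 1 := rfl

@[simp]
theorem multisetPerm_singleton (x : X) : multisetPerm hlaw {x} = σ x := by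
  have := hlaw.rightCommutative
  change Multiset.foldl (translationStep σ) 1 (x ::ₘ 0) = σ x
  rw [Multiset.foldl_cons, Multiset.foldl_zero]
  simp [translationStep]

theorem foldl_translationStep [RightCommutative (translationStep σ)] (s : Multiset X) :
    ∀ τ υ : Equiv.Perm X, s.foldl (translationStep σ) (τ * υ) =
      (s.map υ).foldl (translationStep σ) τ * υ := by
  induction s using Multiset.induction with
  | empty => intro τ υ; simp
  | cons x s ih =>
    intro τ υ
    simp only [Multiset.foldl_cons, Multiset.map_cons]
    rw [← ih]
    simp [translationStep, mul_assoc]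

theorem multisetPerm_add (s t : Multiset X) :
    multisetPerm hlaw (s + t) =
      multisetPerm hlaw (t.map (multisetPerm hlaw s)) * multisetPerm hlaw s := by
  have := hlaw.rightCommutative
  unfold multisetPerm
  rw [Multiset.foldl_add, ← foldl_translationStep, one_mul]

theorem multisetPerm_mem (s : Multiset X) : multisetPerm hlaw s ∈ permGroup σ := by
  induction s using Multiset.induction with
  | empty => exact one_mem _
  | cons x s ih =>
    rw [← Multiset.singleton_add, add_comm, multisetPerm_add]
    refine mul_mem ?_ ih
    rw [Multiset.map_singleton, multisetPerm_singleton]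
    exact Subgroup.subset_closure ⟨_, rfl⟩

theorem multisetPerm_add_map_symm (s t : Multiset X) :
    multisetPerm hlaw (s + t.map (multisetPerm hlaw s).symm) =
      multisetPerm hlaw t * multisetPerm hlaw s := by
  rw [multisetPerm_add]
  simp

theorem exists_multisetPerm_eq [Finite X] {g : Equiv.Perm X} (hg : g ∈ permGroup σ) :
    ∃ s, multisetPerm hlaw s = g := by
  replace hg : g ∈ (permGroup σ).toSubmonoid := hg
  rw [permGroup, Subgroup.closure_toSubmonoid_of_finite] at hg
  induction hg using Submonoid.closure_induction with
  | mem g h =>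
    obtain ⟨x, rfl⟩ := h
    exact ⟨{x}, multisetPerm_singleton hlaw x⟩
  | one => exact ⟨0, rfl⟩
  | mul g h _ _ ihg ihh =>
    obtain ⟨s, rfl⟩ := ihg
    obtain ⟨t, rfl⟩ := ihh
    exact ⟨_, multisetPerm_add_map_symm hlaw t s⟩

/-- Two multisets are identified when they evaluate to the same permutation. -/
def multisetPermCon : AddCon (Multiset X) where
  r s t := multisetPerm hlaw s = multisetPerm hlaw t
  iseqv := ⟨fun _ => rfl, Eq.symm, Eq.trans⟩
  add' {s s' t t'} h h' := by
    have aux : ∀ {u v : Multiset X} (w), multisetPerm hlaw u = multisetPerm hlaw v →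
        multisetPerm hlaw (u + w) = multisetPerm hlaw (v + w) := fun w h => by
      rw [multisetPerm_add, multisetPerm_add, h]
    rw [aux t h, add_comm, aux s' h', add_comm]

theorem multisetPerm_map_congr [Finite X] {g : Equiv.Perm X} (hg : g ∈ permGroup σ)
    {s t : Multiset X} (h : multisetPerm hlaw s = multisetPerm hlaw t) :
    multisetPerm hlaw (s.map g) = multisetPerm hlaw (t.map g) := by
  obtain ⟨u, rfl⟩ := exists_multisetPerm_eq hlaw hg
  have := (multisetPermCon hlaw).add ((multisetPermCon hlaw).refl u) h
  change multisetPerm hlaw (u + s) = multisetPerm hlaw (u + t) at this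
  rwa [multisetPerm_add, multisetPerm_add, mul_left_inj] at this

/-- The additive group of the brace on the permutation group of a cycle set. -/
abbrev BraceAdd : Type _ := (multisetPermCon hlaw).Quotient

variable [Finite X]

theorem BraceAdd.exists_add_eq_zero (a : BraceAdd hlaw) : ∃ b, b + a = 0 := by
  induction a using AddCon.induction_on with
  | H s =>
    obtain ⟨t, ht⟩ := exists_multisetPerm_eq hlaw (inv_mem (multisetPerm_mem hlaw s))
    refine ⟨((t.map (multisetPerm hlaw s).symm : Multiset X) : BraceAdd hlaw), ?_⟩
    rw [add_comm, ← AddCon.coe_add, ← AddCon.coe_zero, AddCon.eq]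
    change multisetPerm hlaw _ = 1
    rw [multisetPerm_add_map_symm, ht, inv_mul_cancel]

noncomputable instance : Neg (BraceAdd hlaw) :=
  ⟨fun a => (BraceAdd.exists_add_eq_zero hlaw a).choose⟩

noncomputable instance : AddCommGroup (BraceAdd hlaw) :=
  { (inferInstance : AddCommMonoid (BraceAdd hlaw)) with
    neg_add_cancel := fun a => (BraceAdd.exists_add_eq_zero hlaw a).choose_spec
    zsmul := zsmulRec }

instance : DistribMulAction (permGroup σ) (BraceAdd hlaw) where
  smul g := AddCon.lift _
    ((AddCon.mk' (multisetPermCon hlaw)).comp (Multiset.mapAddMonoidHom (g : Equiv.Perm X)))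
    fun _ _ h => (AddCon.eq _).2 (multisetPerm_map_congr hlaw g.2 h)
  one_smul a := by
    induction a using AddCon.induction_on with
    | H s => exact congrArg _ (Multiset.map_id s)
  mul_smul g h a := by
    induction a using AddCon.induction_on with
    | H s => exact congrArg _ (Multiset.map_map (g : Equiv.Perm X) (h : Equiv.Perm X) s).symm
  smul_zero g := map_zero (AddCon.lift _ _ _)
  smul_add g := map_add (AddCon.lift _ _ _)

theorem BraceAdd.smul_coe (g : permGroup σ) (s : Multiset X) :
    g • (s : BraceAdd hlaw) = ((s.map (g : Equiv.Perm X) : Multiset X) : BraceAdd hlaw) := rfl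

end AdditiveStructure

/-- A linear structure on the permutation group of a cycle set: a bijective 1-cocycle from
`permGroup σ` to an additive group `A` (given through its inverse `toPerm`), together with an
equivariant family of generators mapping to the inverses of the left translations. -/
structure LinearStructure {X : Type*} (σ : X → Equiv.Perm X) (A : Type*) [AddCommGroup A]
    [DistribMulAction (permGroup σ) A] where
  /-- The underlying bijection. -/
  toPerm : A ≃ permGroup σ
  /-- The generators. -/
  gen : X → A
  toPerm_add_smul : ∀ a b, toPerm (a + toPerm a • b) = toPerm a * toPerm b
  gen_smul : ∀ (g : permGroup σ) x, gen (g • x) = g • gen x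
  toPerm_gen : ∀ x, toPerm (gen x) = (sigmaG σ x)⁻¹
  closure_gen : AddSubmonoid.closure (Set.range gen) = ⊤

/-- The linear structure on the permutation group of a finite cycle set. -/
noncomputable def CycleSetLaw.linearStructure {X : Type*} [Finite X] {σ : X → Equiv.Perm X}
    (hlaw : CycleSetLaw σ) : LinearStructure σ (BraceAdd hlaw) where
  toPerm := Equiv.ofBijective
    (fun a => (⟨AddCon.liftOn a (multisetPerm hlaw) fun _ _ h => h,
      AddCon.induction_on a (multisetPerm_mem hlaw)⟩ : permGroup σ)⁻¹) <| by
    constructor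
    · intro a b h
      induction a using AddCon.induction_on with
      | H s =>
        induction b using AddCon.induction_on with
        | H t => exact (AddCon.eq _).2 (congrArg Subtype.val (inv_injective h))
    · intro g
      obtain ⟨s, hs⟩ := exists_multisetPerm_eq hlaw (g⁻¹).2
      exact ⟨s, inv_eq_iff_eq_inv.2 (Subtype.ext hs)⟩
  gen x := (({x} : Multiset X) : BraceAdd hlaw)
  toPerm_add_smul a b := by
    induction a using AddCon.induction_on with
    | H s =>
      induction b using AddCon.induction_on with
      | H t =>
        refine Eq.trans (inv_inj.2 (Subtype.ext ?_)) (mul_inv_rev _ _)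
        exact multisetPerm_add_map_symm hlaw s t
  gen_smul g x := by
    rw [BraceAdd.smul_coe, Multiset.map_singleton]
    rfl
  toPerm_gen x := inv_inj.2 (Subtype.ext (multisetPerm_singleton hlaw x))
  closure_gen := by
    refine (AddSubmonoid.eq_top_iff' _).2 fun a => ?_
    induction a using AddCon.induction_on with
    | H s =>
      induction s using Multiset.induction with
      | empty => exact zero_mem _
      | cons x s ih =>
        rw [← Multiset.singleton_add, AddCon.coe_add]
        exact add_mem (AddSubmonoid.subset_closure ⟨x, rfl⟩) ih

/-- A faithful transitive action of a commutative group is regular. -/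
theorem natCard_eq_of_comm_of_isPretransitive {H X : Type*} [Group H] [IsMulCommutative H]
    [MulAction H X] [FaithfulSMul H X] [MulAction.IsPretransitive H X] [Nonempty X] :
    Nat.card H = Nat.card X := by
  obtain ⟨x⟩ := ‹Nonempty X›
  refine Nat.card_eq_of_bijective (fun h : H => h • x) ⟨fun g h hgh => ?_, fun y => ?_⟩
  · refine FaithfulSMul.eq_of_smul_eq_smul (α := X) fun y => ?_
    obtain ⟨k, rfl⟩ := MulAction.exists_smul_eq H x y
    rw [← mul_smul, ← mul_smul, mul_comm' g, mul_comm' h, mul_smul, mul_smul]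
    exact congrArg (k • ·) hgh
  · exact MulAction.exists_smul_eq H x y

theorem natCard_dvd_of_isPretransitive (G X : Type*) [Group G] [MulAction G X]
    [MulAction.IsPretransitive G X] [Nonempty X] : Nat.card X ∣ Nat.card G := by
  obtain ⟨x⟩ := ‹Nonempty X›
  rw [← MulAction.index_stabilizer_of_transitive G x]
  exact Subgroup.index_dvd_card _

open Pointwise in
/-- An equivariant map out of a primitive action is injective or constant. -/
theorem injective_or_const_of_isPreprimitive {G X Y : Type*} [Group G] [MulAction G X]
    [MulAction G Y] [MulAction.IsPreprimitive G X] (f : X → Y)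
    (hf : ∀ (g : G) x, f (g • x) = g • f x) :
    Function.Injective f ∨ ∀ x y, f x = f y := by
  by_contra! h
  obtain ⟨hinj, a, b, hab⟩ := h
  obtain ⟨x, y, hxy, hne⟩ := Function.not_injective_iff.1 hinj
  have hblock : MulAction.IsBlock G {z | f z = f x} := by
    refine MulAction.isBlock_iff_smul_eq_of_mem.2 fun g c (hc : f c = f x) hgc => ?_
    have hg : g • f x = f x := by
      rw [← hc, ← hf, hc]
      exact hgc
    ext z
    rw [Set.mem_smul_set_iff_inv_smul_mem]
    change f (g⁻¹ • z) = f x ↔ f z = f x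
    rw [hf, inv_smul_eq_iff, hg]
  rcases MulAction.IsPreprimitive.isTrivialBlock_of_isBlock hblock with hs | hs
  · exact hne (hs (Eq.refl (f x)) hxy.symm)
  · have hall : ∀ z, f z = f x := fun z => (hs ▸ Set.mem_univ z : z ∈ {z | f z = f x})
    exact hab ((hall a).trans (hall b).symm)

/-- Every subgroup of a cyclic normal subgroup is normal. -/
theorem Subgroup.normal_of_le_isCyclic {G : Type*} [Group G] {D N : Subgroup G} [D.Normal]
    [IsCyclic D] (h : N ≤ D) : N.Normal := by
  refine ⟨fun n hn g => ?_⟩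
  obtain ⟨m, hm⟩ := (MulAut.conjNormal g : MulAut D).toMonoidHom.map_cyclic
  have key : g * n * g⁻¹ = n ^ m := congrArg Subtype.val (hm ⟨n, h hn⟩)
  rw [key]
  exact zpow_mem hn m

theorem Indecomposable.isPretransitive {X : Type*} {σ : X → Equiv.Perm X}
    (h : Indecomposable σ) : MulAction.IsPretransitive (permGroup σ) X :=
  ⟨fun x y => by
    obtain ⟨g, hg, hxy⟩ := h x y
    exact ⟨⟨g, hg⟩, hxy⟩⟩

/-- A normal subgroup of the permutation group of a simple left quasigroup whose orbits form a
congruence is trivial or transitive. -/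
theorem SimpleLQ.eq_bot_or_isPretransitive {X : Type*} {σ : X → Equiv.Perm X} (hs : SimpleLQ σ)
    (N : Subgroup (permGroup σ)) [hN : N.Normal]
    (h : ∀ n ∈ N, ∀ x : X, (sigmaG σ (n • x))⁻¹ * sigmaG σ x ∈ N) :
    N = ⊥ ∨ MulAction.IsPretransitive N X := by
  have hcong : IsCongruence σ fun x y => ∃ n ∈ N, n • x = y := by
    refine ⟨⟨?_, ?_, ?_⟩, ?_, ?_⟩
    · exact fun x => ⟨1, one_mem N, one_smul _ x⟩
    · rintro x _ ⟨n, hn, rfl⟩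
      exact ⟨n⁻¹, inv_mem hn, inv_smul_smul n x⟩
    · rintro x _ _ ⟨n, hn, rfl⟩ ⟨k, hk, rfl⟩
      exact ⟨k * n, mul_mem hk hn, mul_smul k n x⟩
    · rintro x _ y _ ⟨n, hn, rfl⟩ ⟨k, hk, rfl⟩
      have key := h n hn x
      set s := sigmaG σ x
      set s' := sigmaG σ (n • x)
      have hmem : s' * (k * (s'⁻¹ * s)⁻¹) * s'⁻¹ ∈ N :=
        hN.conj_mem _ (mul_mem hk (inv_mem key)) s'
      refine ⟨_, hmem, ?_⟩
      change _ • (s • y) = s' • (k • y)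
      rw [← mul_smul, ← mul_smul]
      congr 1
      group
    · rintro x _ y _ ⟨n, hn, rfl⟩ ⟨k, hk, rfl⟩
      have key := h n hn x
      set s := sigmaG σ x
      set s' := sigmaG σ (n • x)
      have hmem : s'⁻¹ * k * (s'⁻¹)⁻¹ * (s'⁻¹ * s) ∈ N :=
        mul_mem (hN.conj_mem _ hk s'⁻¹) key
      refine ⟨_, hmem, ?_⟩
      change _ • (s⁻¹ • y) = s'⁻¹ • (k • y)
      rw [← mul_smul, ← mul_smul]
      congr 1
      group
  rcases hs.2 _ hcong with hr | hr
  · left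
    refine (Subgroup.eq_bot_iff_forall N).2 fun n hn => ?_
    exact FaithfulSMul.eq_of_smul_eq_smul (α := X) fun x => by
      rw [one_smul]
      exact ((hr x (n • x)).1 ⟨n, hn, rfl⟩).symm
  · right
    exact ⟨fun x y => by
      obtain ⟨n, hn, hxy⟩ := hr x y
      exact ⟨⟨n, hn⟩, hxy⟩⟩

namespace LinearStructure

variable {X : Type*} {σ : X → Equiv.Perm X} {A : Type*} [AddCommGroup A]
  [DistribMulAction (permGroup σ) A] (L : LinearStructure σ A)

theorem toPerm_add (a b : A) :
    L.toPerm (a + b) = L.toPerm a * L.toPerm ((L.toPerm a)⁻¹ • b) := by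
  rw [← L.toPerm_add_smul, smul_inv_smul]

theorem toPerm_zero : L.toPerm 0 = 1 := by
  simpa using L.toPerm_add_smul 0 0

theorem symm_mul (g h : permGroup σ) :
    L.toPerm.symm (g * h) = L.toPerm.symm g + g • L.toPerm.symm h := by
  rw [Equiv.symm_apply_eq]
  simpa using (L.toPerm_add_smul (L.toPerm.symm g) (L.toPerm.symm h)).symm

theorem symm_one : L.toPerm.symm 1 = 0 := by
  rw [Equiv.symm_apply_eq, toPerm_zero]

theorem symm_inv (g : permGroup σ) : L.toPerm.symm g⁻¹ = -(g⁻¹ • L.toPerm.symm g) := by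
  have := L.symm_mul g⁻¹ g
  rw [inv_mul_cancel, symm_one] at this
  exact eq_neg_of_add_eq_zero_left this.symm

/-- The subgroup of the permutation group corresponding to an invariant additive subgroup. -/
def subgroupOfInvariant (B : AddSubgroup A) (hB : ∀ (g : permGroup σ), ∀ a ∈ B, g • a ∈ B) :
    Subgroup (permGroup σ) where
  carrier := {g | L.toPerm.symm g ∈ B}
  mul_mem' {g h} hg hh := by
    rw [Set.mem_ofPred_eq, symm_mul]
    exact add_mem hg (hB g _ hh)
  one_mem' := by
    rw [Set.mem_ofPred_eq, symm_one]
    exact zero_mem B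
  inv_mem' {g} hg := by
    rw [Set.mem_ofPred_eq, symm_inv]
    exact neg_mem (hB _ _ hg)

theorem natCard_eq {N : Subgroup (permGroup σ)} {B : AddSubgroup A}
    (h : ∀ g, g ∈ N ↔ L.toPerm.symm g ∈ B) : Nat.card N = Nat.card B :=
  Nat.card_congr (L.toPerm.symm.subtypeEquiv h)

/-- The orbits of an ideal form a congruence. -/
theorem sigmaG_inv_mul_mem {N : Subgroup (permGroup σ)} [hN : N.Normal] {B : AddSubgroup A}
    (hB : ∀ (g : permGroup σ), ∀ a ∈ B, g • a ∈ B)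
    (h : ∀ g, g ∈ N ↔ L.toPerm.symm g ∈ B) {n : permGroup σ} (hn : n ∈ N) (x : X) :
    (sigmaG σ (n • x))⁻¹ * sigmaG σ x ∈ N := by
  have key : n * (sigmaG σ x)⁻¹ = (sigmaG σ (n • x))⁻¹ *
      L.toPerm ((sigmaG σ (n • x)) • L.toPerm.symm n) := by
    apply L.toPerm.symm.injective
    rw [symm_mul, symm_mul, ← L.toPerm_gen, ← L.toPerm_gen, Equiv.symm_apply_apply,
      Equiv.symm_apply_apply, Equiv.symm_apply_apply, gen_smul, ← gen_smul, toPerm_gen,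
      inv_smul_smul, add_comm]
  have hk : L.toPerm ((sigmaG σ (n • x)) • L.toPerm.symm n) ∈ N := by
    rw [h, Equiv.symm_apply_apply]
    exact hB _ _ ((h n).1 hn)
  rw [← mul_inv_eq_iff_eq_mul] at key
  rw [← key]
  have := mul_mem hn (hN.conj_mem _ (inv_mem hk) (sigmaG σ x)⁻¹)
  simpa [mul_assoc] using this

theorem eq_bot_or_isPretransitive (hs : SimpleLQ σ) {N : Subgroup (permGroup σ)} [N.Normal]
    {B : AddSubgroup A} (hB : ∀ (g : permGroup σ), ∀ a ∈ B, g • a ∈ B)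
    (h : ∀ g, g ∈ N ↔ L.toPerm.symm g ∈ B) : N = ⊥ ∨ MulAction.IsPretransitive N X :=
  hs.eq_bot_or_isPretransitive N fun _ hn x => L.sigmaG_inv_mul_mem hB h hn x

theorem induction_gen {p : A → Prop} (h0 : p 0) (hgen : ∀ x, p (L.gen x))
    (hadd : ∀ a b, p a → p b → p (a + b)) (a : A) : p a := by
  have ha : a ∈ AddSubmonoid.closure (Set.range L.gen) := by
    rw [L.closure_gen]
    exact AddSubmonoid.mem_top a
  induction ha using AddSubmonoid.closure_induction with
  | mem a h =>
    obtain ⟨x, rfl⟩ := h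
    exact hgen x
  | zero => exact h0
  | add a b _ _ iha ihb => exact hadd a b iha ihb

/-- If all generators agree, the displacement group is trivial. -/
theorem dis_eq_bot (h : ∀ x y, L.gen x = L.gen y) : dis σ = ⊥ := by
  refine eq_bot_iff.2 (Subgroup.normalClosure_le_normal ?_)
  rintro g ⟨x, y, hg⟩
  have hxy : sigmaG σ x = sigmaG σ y := by
    rw [← inv_inj, ← L.toPerm_gen, ← L.toPerm_gen, h x y]
  have hxy' : σ x = σ y := congrArg Subtype.val hxy
  refine Subgroup.mem_bot.2 (Subtype.ext ?_)
  rw [hg, hxy', mul_inv_cancel]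
  rfl

/-- In an indecomposable cycle set of prime cardinality all generators agree. -/
theorem gen_eq_of_prime (htr : Indecomposable σ) (hp : (Nat.card X).Prime) (x y : X) :
    L.gen x = L.gen y := by
  have := htr.isPretransitive
  have : Finite X := Nat.finite_of_card_ne_zero hp.ne_zero
  have : Nonempty X := ⟨x⟩
  have : Finite A := Finite.of_equiv _ L.toPerm.symm
  have : Fact (Nat.card X).Prime := ⟨hp⟩
  have hprim : MulAction.IsPreprimitive (permGroup σ) X := MulAction.IsPreprimitive.of_prime_card hp
  set p := Nat.card X with hpX
  have hcard : Nat.card A = Nat.card (permGroup σ) := Nat.card_congr L.toPerm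
  have hpdvd : p ∣ Nat.card A := by
    rw [hcard]
    exact natCard_dvd_of_isPretransitive (permGroup σ) X
  obtain ⟨m, hm⟩ := hpdvd
  have hpm : ¬ p ∣ m := by
    intro hdvd
    have h1 : p * p ∣ p.factorial := by
      refine (mul_dvd_mul_left p hdvd).trans ?_
      rw [← hm, hcard, hpX, ← Nat.card_perm]
      exact Subgroup.card_subgroup_dvd_card _
    rw [← Nat.mul_factorial_pred hp.ne_zero] at h1
    have h2 := (hp.dvd_factorial).1 (Nat.dvd_of_mul_dvd_mul_left hp.pos h1)
    have := hp.pos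
    omega
  have hpt : ∀ a : A, p • m • a = 0 := fun a => by
    rw [← mul_smul, ← hm, card_nsmul_eq_zero']
  let P : AddSubgroup A := (nsmulAddMonoidHom (α := A) p).ker
  have hPcard : Nat.card P ≤ p := by
    have hPg : IsPGroup p (Multiplicative P) := fun a => ⟨1, by
      rw [pow_one]
      exact congrArg Multiplicative.ofAdd (Subtype.ext a.toAdd.2)⟩
    obtain ⟨k, hk⟩ := IsPGroup.iff_card.1 hPg
    have hk' : Nat.card P = p ^ k := hk
    have hdvd : p ^ k ∣ p * m := by
      rw [← hk', ← hm]
      exact AddSubgroup.card_addSubgroup_dvd_card P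
    rcases Nat.lt_or_ge k 2 with hk2 | hk2
    · rw [hk']
      calc p ^ k ≤ p ^ 1 := Nat.pow_le_pow_right hp.pos (by omega)
        _ = p := pow_one p
    · refine absurd ?_ hpm
      refine Nat.dvd_of_mul_dvd_mul_left hp.pos (((pow_two p).symm.dvd.trans ?_).trans hdvd)
      exact pow_dvd_pow p hk2
  have hconst : ∀ z w, m • L.gen z = m • L.gen w := by
    have heq : ∀ (g : permGroup σ) z, m • L.gen (g • z) = g • m • L.gen z := fun g z => by
      rw [L.gen_smul, smul_comm]
    refine (injective_or_const_of_isPreprimitive _ heq).resolve_left fun hinj => ?_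
    let f : X → P := fun z => ⟨m • L.gen z, hpt _⟩
    have hf : Function.Injective f := fun z w h => hinj (congrArg Subtype.val h)
    obtain ⟨z, hz⟩ := (hf.bijective_of_nat_card_le hPcard).2 0
    have hz0 : m • L.gen z = 0 := congrArg Subtype.val hz
    have hall : ∀ w, w = z := fun w => by
      obtain ⟨g, rfl⟩ := MulAction.exists_smul_eq (permGroup σ) z w
      refine hinj ?_
      change m • L.gen (g • z) = m • L.gen z
      rw [heq, hz0, smul_zero]
    have : Subsingleton X := ⟨fun a b => (hall a).trans (hall b).symm⟩
    exact hp.one_lt.not_ge (Finite.card_le_one_iff_subsingleton.2 this)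
  have hfix : ∀ (g : permGroup σ) (a : A), g • m • a = m • a := fun g a => by
    induction a using L.induction_gen with
    | h0 => simp
    | hgen z => rw [smul_comm, ← L.gen_smul, hconst]
    | hadd a b ha hb => rw [smul_add, smul_add, ha, hb]
  let ψ : permGroup σ →* Multiplicative A :=
    { toFun := fun g => Multiplicative.ofAdd (m • L.toPerm.symm g)
      map_one' := by simp [symm_one]
      map_mul' := fun g h => by
        rw [symm_mul, smul_add, ← smul_comm g m, hfix, ofAdd_add] }
  have hψ : ∀ g, g ∈ ψ.ker ↔ L.toPerm.symm g ∈ (nsmulAddMonoidHom (α := A) m).ker :=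
    fun g => Iff.rfl
  have hKcard : ¬ p ∣ Nat.card ψ.ker := by
    rw [L.natCard_eq hψ]
    intro hdvd
    obtain ⟨b, hb⟩ := exists_prime_addOrderOf_dvd_card' p hdvd
    have : m • b = 0 := Subtype.ext b.2
    exact hpm (hb ▸ addOrderOf_dvd_of_nsmul_eq_zero this)
  have hK : ψ.ker = ⊥ := by
    by_contra hne
    have hfp : MulAction.fixedPoints ψ.ker X ≠ Set.univ := by
      intro hfp
      refine hne ((Subgroup.eq_bot_iff_forall _).2 fun g hg => ?_)
      refine FaithfulSMul.eq_of_smul_eq_smul (α := X) fun z => ?_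
      rw [one_smul]
      exact (hfp ▸ Set.mem_univ z : z ∈ MulAction.fixedPoints ψ.ker X) ⟨g, hg⟩
    have := MulAction.IsQuasiPreprimitive.isPretransitive_of_normal hfp
    exact hKcard (natCard_dvd_of_isPretransitive ψ.ker X)
  apply L.toPerm.injective
  apply (MonoidHom.ker_eq_bot_iff ψ).1 hK
  change Multiplicative.ofAdd (m • L.toPerm.symm (L.toPerm (L.gen x))) =
    Multiplicative.ofAdd (m • L.toPerm.symm (L.toPerm (L.gen y)))
  rw [Equiv.symm_apply_apply, Equiv.symm_apply_apply, hconst x y]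

end LinearStructure

instance {X : Type*} (σ : X → Equiv.Perm X) : (dis σ).Normal :=
  Subgroup.normalClosure_normal

namespace LinearStructure

variable {X : Type*} {σ : X → Equiv.Perm X} {A : Type*} [AddCommGroup A]
  [DistribMulAction (permGroup σ) A] (L : LinearStructure σ A)

theorem mk_toPerm_smul (g : permGroup σ) (a : A) :
    (L.toPerm (g • a) : permGroup σ ⧸ dis σ) = L.toPerm a := by
  induction a using L.induction_gen generalizing g with
  | h0 => rw [smul_zero]
  | hgen x =>
    rw [← L.gen_smul, L.toPerm_gen, L.toPerm_gen, QuotientGroup.eq, inv_inv]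
    exact Subgroup.subset_normalClosure ⟨_, _, rfl⟩
  | hadd a b ha hb =>
    rw [smul_add, toPerm_add, toPerm_add, QuotientGroup.mk_mul, QuotientGroup.mk_mul, ha,
      ← mul_smul, hb, hb]

/-- The additive subgroup corresponding to the displacement group. -/
def disAdd : AddSubgroup A :=
  AddMonoidHom.ker
    { toFun := fun a => Additive.ofMul (L.toPerm a : permGroup σ ⧸ dis σ)
      map_zero' := by rw [toPerm_zero]; rfl
      map_add' := fun a b => by
        rw [toPerm_add, QuotientGroup.mk_mul, mk_toPerm_smul, ofMul_mul] }

theorem mem_disAdd {a : A} : a ∈ L.disAdd ↔ L.toPerm a ∈ dis σ :=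
  QuotientGroup.eq_one_iff (L.toPerm a)

theorem mem_dis_iff (g : permGroup σ) : g ∈ dis σ ↔ L.toPerm.symm g ∈ L.disAdd := by
  rw [mem_disAdd, Equiv.apply_symm_apply]

theorem smul_mem_disAdd (g : permGroup σ) (a : A) (ha : a ∈ L.disAdd) : g • a ∈ L.disAdd := by
  rw [mem_disAdd, ← QuotientGroup.eq_one_iff] at ha ⊢
  rw [mk_toPerm_smul, ha]

/-- In a simple cycle set with nontrivial cyclic displacement group, the displacement group is
regular and is minimal among the invariant additive subgroups. -/
theorem eq_disAdd_of_isCyclic [Finite X] [Nonempty X] (hs : SimpleLQ σ) [IsCyclic (dis σ)]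
    (hne : dis σ ≠ ⊥) {B : AddSubgroup A} (hB : ∀ (g : permGroup σ), ∀ a ∈ B, g • a ∈ B)
    (hle : B ≤ L.disAdd) (hbot : B ≠ ⊥) : B = L.disAdd := by
  have : Finite A := Finite.of_equiv _ L.toPerm.symm
  have hD := (L.eq_bot_or_isPretransitive hs L.smul_mem_disAdd L.mem_dis_iff).resolve_left hne
  let N := L.subgroupOfInvariant B hB
  have hmem : ∀ g, g ∈ N ↔ L.toPerm.symm g ∈ B := fun _ => Iff.rfl
  have : N.Normal := Subgroup.normal_of_le_isCyclic fun g hg => (L.mem_dis_iff g).2 (hle hg)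
  rcases L.eq_bot_or_isPretransitive hs hB hmem with hN | hN
  · refine absurd ((AddSubgroup.eq_bot_iff_forall B).2 fun b hb => ?_) hbot
    have hb' : L.toPerm b ∈ N := by rwa [hmem, Equiv.symm_apply_apply]
    rw [hN, Subgroup.mem_bot] at hb'
    rw [← L.toPerm.symm_apply_apply b, hb', symm_one]
  · refine AddSubgroup.eq_of_le_of_card_ge hle ?_
    rw [← L.natCard_eq hmem, ← L.natCard_eq L.mem_dis_iff,
      natCard_eq_of_comm_of_isPretransitive (H := dis σ) (X := X)]
    exact Nat.le_of_dvd Nat.card_pos (natCard_dvd_of_isPretransitive N X)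

/-- A finite simple cycle set with nontrivial cyclic displacement group has prime cardinality. -/
theorem prime_card_of_isCyclic (L : LinearStructure σ A) [Finite X] [Nonempty X]
    (hs : SimpleLQ σ) [IsCyclic (dis σ)] (hne : dis σ ≠ ⊥) : (Nat.card X).Prime := by
  have : Finite A := Finite.of_equiv _ L.toPerm.symm
  have hD := (L.eq_bot_or_isPretransitive hs L.smul_mem_disAdd L.mem_dis_iff).resolve_left hne
  rw [← natCard_eq_of_comm_of_isPretransitive (H := dis σ) (X := X)]
  have hone : Nat.card (dis σ) ≠ 1 := fun h => hne (Subgroup.card_eq_one.1 h)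
  obtain ⟨p, hp, hpdvd⟩ := Nat.exists_prime_and_dvd hone
  have : Fact p.Prime := ⟨hp⟩
  rw [L.natCard_eq L.mem_dis_iff] at hpdvd
  have htors : ∀ a ∈ L.disAdd, p • a = 0 := by
    have heq : L.disAdd ⊓ (nsmulAddMonoidHom (α := A) p).ker = L.disAdd := by
      refine L.eq_disAdd_of_isCyclic hs hne (fun g a ha => ?_) inf_le_left ?_
      · refine ⟨L.smul_mem_disAdd g a ha.1, ?_⟩
        have h2 : p • a = 0 := ha.2
        change p • g • a = 0
        rw [smul_comm, h2, smul_zero]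
      · obtain ⟨b, hb⟩ := exists_prime_addOrderOf_dvd_card' p hpdvd
        intro hbot
        have hb0 : (b : A) ∈ (⊥ : AddSubgroup A) := by
          rw [← hbot]
          refine ⟨b.2, ?_⟩
          have := addOrderOf_nsmul_eq_zero b
          rw [hb] at this
          exact congrArg Subtype.val this
        have : b = 0 := Subtype.ext hb0
        rw [this, addOrderOf_zero] at hb
        exact hp.one_lt.ne hb
    intro a ha
    rw [← heq] at ha
    exact ha.2
  have hpg : IsPGroup p (dis σ) := by
    have hPg : IsPGroup p (Multiplicative L.disAdd) := fun a => ⟨1, by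
      rw [pow_one]
      exact congrArg Multiplicative.ofAdd (Subtype.ext (htors _ a.toAdd.2))⟩
    obtain ⟨k, hk⟩ := IsPGroup.iff_card.1 hPg
    exact IsPGroup.of_card (n := k) ((L.natCard_eq L.mem_dis_iff).trans hk)
  have hfix : ∀ d ∈ dis σ, ∀ a ∈ L.disAdd, d • a = a := by
    let F : AddSubgroup A :=
      { carrier := {a | a ∈ L.disAdd ∧ ∀ d ∈ dis σ, d • a = a}
        zero_mem' := ⟨zero_mem _, fun d _ => smul_zero d⟩
        add_mem' := fun ha hb => ⟨add_mem ha.1 hb.1, fun d hd => by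
          rw [smul_add, ha.2 d hd, hb.2 d hd]⟩
        neg_mem' := fun ha => ⟨neg_mem ha.1, fun d hd => by rw [smul_neg, ha.2 d hd]⟩ }
    have heq : F = L.disAdd := by
      refine L.eq_disAdd_of_isCyclic hs hne (fun g a ha => ?_) (fun a ha => ha.1) ?_
      · refine ⟨L.smul_mem_disAdd g a ha.1, fun d hd => ?_⟩
        have := ha.2 _ (Subgroup.Normal.conj_mem inferInstance d hd g⁻¹)
        rw [inv_inv, mul_smul, mul_smul, inv_smul_eq_iff] at this
        exact this
      · let : MulAction (dis σ) L.disAdd :=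
          { smul := fun d a => ⟨(d : permGroup σ) • (a : A), L.smul_mem_disAdd _ _ a.2⟩
            one_smul := fun a => Subtype.ext (one_smul (permGroup σ) (a : A))
            mul_smul := fun d e a =>
              Subtype.ext (mul_smul (d : permGroup σ) (e : permGroup σ) (a : A)) }
        have h0 : (0 : L.disAdd) ∈ MulAction.fixedPoints (dis σ) L.disAdd := fun d =>
          Subtype.ext (smul_zero (d : permGroup σ))
        obtain ⟨b, hb, hb0⟩ := hpg.exists_fixed_point_of_prime_dvd_card_of_fixed_point _ hpdvd h0
        intro hbot
        have hbF : (b : A) ∈ F := ⟨b.2, fun d hd => congrArg Subtype.val (hb ⟨d, hd⟩)⟩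
        rw [hbot] at hbF
        exact hb0 (Subtype.ext hbF.symm)
    intro d hd a ha
    rw [← heq] at ha
    exact ha.2 d hd
  have hpow : ∀ d ∈ dis σ, d ^ p = 1 := by
    intro d hd
    have hk : ∀ k : ℕ, L.toPerm.symm (d ^ k) = k • L.toPerm.symm d := by
      intro k
      induction k with
      | zero => rw [pow_zero, symm_one, zero_smul]
      | succ k ih =>
        rw [pow_succ, symm_mul, ih, hfix _ (pow_mem hd k) _ ((L.mem_dis_iff d).1 hd), succ_nsmul]
    apply L.toPerm.symm.injective
    rw [hk, htors _ ((L.mem_dis_iff d).1 hd), symm_one]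
  obtain ⟨d, hd⟩ := IsCyclic.exists_generator (α := dis σ)
  have hcard : Nat.card (dis σ) ∣ p := by
    rw [← orderOf_eq_card_of_forall_mem_zpowers hd]
    exact orderOf_dvd_of_pow_eq_one (Subtype.ext (hpow d d.2))
  rwa [((Nat.dvd_prime hp).1 hcard).resolve_left hone]

end LinearStructure

/-- A finite simple left quasigroup with trivial displacement group has prime cardinality. -/
theorem SimpleLQ.prime_card_of_dis_eq_bot {X : Type*} [Finite X] {σ : X → Equiv.Perm X}
    (hs : SimpleLQ σ) (hcard : 1 < Nat.card X) (h : dis σ = ⊥) : (Nat.card X).Prime := by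
  have : Nonempty X := (Nat.card_pos_iff.1 (by omega)).1
  have := hs.1.isPretransitive
  have hσ : ∀ x y, sigmaG σ x = sigmaG σ y := fun x y => by
    have hmem : sigmaG σ x * (sigmaG σ y)⁻¹ ∈ dis σ :=
      Subgroup.subset_normalClosure ⟨x, y, rfl⟩
    rw [h, Subgroup.mem_bot] at hmem
    exact mul_inv_eq_one.1 hmem
  have hcomm : ∀ a b : permGroup σ, a * b = b * a := by
    have : IsMulCommutative (permGroup σ) := by
      refine Subgroup.isMulCommutative_closure ?_
      rintro _ ⟨x, rfl⟩ _ ⟨y, rfl⟩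
      rw [show σ x = σ y from congrArg Subtype.val (hσ x y)]
    exact mul_comm'
  obtain ⟨p, hp, hpdvd⟩ := Nat.exists_prime_and_dvd hcard.ne'
  have : Fact p.Prime := ⟨hp⟩
  obtain ⟨g, hg⟩ := exists_prime_orderOf_dvd_card' p
    (hpdvd.trans (natCard_dvd_of_isPretransitive (permGroup σ) X))
  have : (Subgroup.zpowers g).Normal := ⟨fun n hn k => by
    rwa [hcomm k n, mul_inv_cancel_right]⟩
  rcases hs.eq_bot_or_isPretransitive (Subgroup.zpowers g) fun n _ x => by
    rw [hσ (n • x) x, inv_mul_cancel]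
    exact one_mem _ with hN | hN
  · rw [Subgroup.zpowers_eq_bot] at hN
    rw [hN, orderOf_one] at hg
    exact absurd hg hp.one_lt.ne
  · have hdvd := natCard_dvd_of_isPretransitive (Subgroup.zpowers g) X
    rw [Nat.card_zpowers, hg] at hdvd
    rwa [((Nat.dvd_prime hp).1 hdvd).resolve_left hcard.ne']

/-- for a finite simple non-degenerate cycle set with `|X| > 1`, the
following are equivalent: (1) `Dis(X)` is cyclic; (2) `Dis(X)` is trivial;
(3) `|X| = 2` or `X` is an indecomposable cycle set of prime cardinality. -/
theorem stmt_9 {X : Type*} [Finite X] (σ : X → Equiv.Perm X)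
    (hlaw : CycleSetLaw σ) (hnd : Nondeg σ) (hs : SimpleLQ σ)
    (hcard : 1 < Nat.card X) :
    (IsCyclic ↥(dis σ) ↔ dis σ = ⊥) ∧
    (dis σ = ⊥ ↔ (Nat.card X = 2 ∨ ((Nat.card X).Prime ∧ Indecomposable σ))) := by
  have : Nonempty X := (Nat.card_pos_iff.1 (by omega)).1
  have L := hlaw.linearStructure
  have hprime : (Nat.card X).Prime → dis σ = ⊥ := fun hp =>
    L.dis_eq_bot (L.gen_eq_of_prime hs.1 hp)
  refine ⟨⟨fun _ => ?_, fun h => ?_⟩, fun h => ?_, ?_⟩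
  · by_contra hne
    exact hne (hprime (L.prime_card_of_isCyclic hs hne))
  · rw [h]
    infer_instance
  · exact Or.inr ⟨hs.prime_card_of_dis_eq_bot hcard h, hs.1⟩
  · rintro (h | h)
    · exact hprime (h ▸ Nat.prime_two)
    · exact hprime h.1
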